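/- arXiv:2006.04789 — 3 statements merged into one kernel-verified Lean document; each statement's English description precedes it below -/
import Mathlib

section
/- Let R be a left and right noetherian ring with an Ore set S of non-zero-divisors, satisfying Assumption (⋆). Let 0 → M' → M → M'' → 0 be an exact sequence of modules in 𝓒. If two of M', M, M'' lie in 𝓟, then so does the third. -/
open CategoryTheory MulOpposite

noncomputable section

/-- `M` is `S`-torsion: every element is annihilated by some element of `S`. -/
def STorsion (R : Type) [Ring R] (S : Submonoid R) (M : Type) [AddCommGroup M] [Module R M] :
    Prop :=
  ∀ m : M, ∃ s ∈ S, s • m = 0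

/-- Projective dimension `≤ n`, witnessed by resolutions with finite free stages. -/
def PdLE (R : Type) [Ring R] : ℕ → (M : Type) → [AddCommGroup M] → [Module R M] → Prop
  | 0, M, _, _ => Module.Projective R M
  | n+1, M, _, _ => ∃ (k : ℕ) (f : (Fin k → R) →ₗ[R] M),
      Function.Surjective f ∧ PdLE R n (LinearMap.ker f)

/-- Finite projective dimension. -/
def FinitePd (R : Type) [Ring R] (M : Type) [AddCommGroup M] [Module R M] : Prop :=
  ∃ n, PdLE R n M

/-- Membership in the category `𝓜` of finitely generated `S`-torsion modules. -/
def MemM (R : Type) [Ring R] (S : Submonoid R) (M : Type) [AddCommGroup M] [Module R M] : Prop :=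
  Module.Finite R M ∧ STorsion R S M

/-- Membership in `𝓟`: finitely generated `S`-torsion of projective dimension `≤ 1`. -/
def MemP (R : Type) [Ring R] (S : Submonoid R) (M : Type) [AddCommGroup M] [Module R M] : Prop :=
  MemM R S M ∧ PdLE R 1 M

/-- Membership in `𝓠`: finitely generated `S`-torsion of finite projective dimension. -/
def MemQ (R : Type) [Ring R] (S : Submonoid R) (M : Type) [AddCommGroup M] [Module R M] : Prop :=
  MemM R S M ∧ FinitePd R M

/-- The Ext group `Ext^i_R(M, N)`. -/
abbrev extGroup (R : Type) [Ring R] (M N : Type) [AddCommGroup M] [Module R M]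
    [AddCommGroup N] [Module R N] (i : ℕ) : Type :=
  (((_root_.Ext ℤ (ModuleCat R) i).obj (Opposite.op (ModuleCat.of R M))).obj (ModuleCat.of R N))

/-- Vanishing of `Ext^i_R(M, R)`. -/
def ExtRVanish (R : Type) [Ring R] (M : Type) [AddCommGroup M] [Module R M] (i : ℕ) : Prop :=
  Subsingleton (extGroup R M R i)

/-- `pd*_R(M) ≤ 1`, i.e. `Ext^i_R(M, R) = 0` for all `i ≥ 2`. -/
def PdStarLE1 (R : Type) [Ring R] (M : Type) [AddCommGroup M] [Module R M] : Prop :=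
  ∀ i, 2 ≤ i → ExtRVanish R M i

/-- Membership in `𝓒`: finitely generated `S`-torsion with `pd* ≤ 1`. -/
def MemC (R : Type) [Ring R] (S : Submonoid R) (M : Type) [AddCommGroup M] [Module R M] : Prop :=
  MemM R S M ∧ PdStarLE1 R M

/-- Assumption (⋆): a uniform bound `d(R)` on `pd*` of all finitely generated left or
right `R`-modules. -/
def AssumptionStar (R : Type) [Ring R] : Prop :=
  ∃ d : ℕ,
    (∀ (M : Type) [AddCommGroup M] [Module R M], Module.Finite R M →
      ∀ i, d < i → ExtRVanish R M i) ∧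
    (∀ (M : Type) [AddCommGroup M] [Module Rᵐᵒᵖ M], Module.Finite Rᵐᵒᵖ M →
      ∀ i, d < i → ExtRVanish Rᵐᵒᵖ M i)

/-- `S` is a (left and right) Ore set consisting of non-zero-divisors. -/
def IsOreSet (R : Type) [Ring R] (S : Submonoid R) : Prop :=
  S ≤ nonZeroDivisors R ∧
    (∀ f ∈ S, ∀ a : R, ∃ r : R, ∃ s ∈ S, f * r = a * s) ∧
    (∀ f ∈ S, ∀ a : R, ∃ r : R, ∃ s ∈ S, r * f = s * a)

/-- A sequence of `R`-modules and maps, used to encode finite exact sequences. -/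
structure ModSeq (R : Type) [Ring R] where
  C : ℕ → Type
  [acg : ∀ i, AddCommGroup (C i)]
  [mod : ∀ i, Module R (C i)]
  f : ∀ i, C i →ₗ[R] C (i+1)

attribute [instance] ModSeq.acg ModSeq.mod

/-- `D.ExactTrunc n` : the window `0 → C 0 → C 1 → ⋯ → C (n+1) → 0` is exact. -/
def ModSeq.ExactTrunc {R : Type} [Ring R] (D : ModSeq R) (n : ℕ) : Prop :=
  Function.Injective (D.f 0) ∧ Function.Surjective (D.f n) ∧
    ∀ i < n, Function.Exact (D.f i) (D.f (i+1))

/-- The (initial) Fitting ideal of a module over a commutative ring. -/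
def fittingIdeal (R : Type) [CommRing R] (M : Type) [AddCommGroup M] [Module R M] : Ideal R :=
  Ideal.span { x : R | ∃ (a : ℕ) (A : Matrix (Fin a) (Fin a) R) (π : (Fin a → R) →ₗ[R] M),
    Function.Surjective π ∧ (∀ j, π (fun i => A i j) = 0) ∧ x = A.det }

/-- The Fitting ideal viewed as a fractional ideal, i.e. a finitely generated
`R`-submodule of `S⁻¹R`. -/
def fittFrac (R : Type) [CommRing R] (S : Submonoid R) (M : Type) [AddCommGroup M]
    [Module R M] : Submodule R (Localization S) :=
  Submodule.map (Algebra.linearMap R (Localization S)) (fittingIdeal R M)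

/-- Precomposition with `ι`, as a map of right `R`-modules `Hom(F, R) → Hom(N, R)`. -/
def precompDual (R : Type) [Ring R] {N F : Type} [AddCommGroup N] [Module R N]
    [AddCommGroup F] [Module R F] (ι : N →ₗ[R] F) :
    (F →ₗ[R] R) →ₗ[Rᵐᵒᵖ] (N →ₗ[R] R) where
  toFun g := g.comp ι
  map_add' _ _ := LinearMap.ext fun _ => rfl
  map_smul' _ _ := LinearMap.ext fun _ => rfl

/-- `Ext^1_R(M, R)` computed from a presentation `0 → N → F → M → 0` with `F` projective:
the cokernel of `Hom(F, R) → Hom(N, R)`; it is a right `R`-module. -/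
abbrev ExtOneDual (R : Type) [Ring R] {N F : Type} [AddCommGroup N] [Module R N]
    [AddCommGroup F] [Module R F] (ι : N →ₗ[R] F) : Type :=
  (N →ₗ[R] R) ⧸ LinearMap.range (precompDual R ι)

/-- Precomposition with `ι`, commutative case. -/
def precompDualComm (R : Type) [CommRing R] {N F : Type} [AddCommGroup N] [Module R N]
    [AddCommGroup F] [Module R F] (ι : N →ₗ[R] F) :
    (F →ₗ[R] R) →ₗ[R] (N →ₗ[R] R) where
  toFun g := g.comp ι
  map_add' _ _ := LinearMap.ext fun _ => rfl
  map_smul' _ _ := LinearMap.ext fun _ => rfl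

/-- `Ext^1_R(M, R)` computed from a presentation, commutative case. -/
abbrev ExtOneDualComm (R : Type) [CommRing R] {N F : Type} [AddCommGroup N] [Module R N]
    [AddCommGroup F] [Module R F] (ι : N →ₗ[R] F) : Type :=
  (N →ₗ[R] R) ⧸ LinearMap.range (precompDualComm R ι)

/-- A Fitting invariant `𝓕 : 𝓜 → Ω`. -/
def IsFittingInv (R : Type) [Ring R] (S : Submonoid R) {Ω : Type} [CommMonoid Ω]
    (F : (M : Type) → [AddCommGroup M] → [Module R M] → Ω) : Prop :=
  (∀ (P : Type) [AddCommGroup P] [Module R P], MemP R S P → IsUnit (F P)) ∧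
  (∀ (M' M P : Type) [AddCommGroup M'] [Module R M'] [AddCommGroup M] [Module R M]
      [AddCommGroup P] [Module R P], MemM R S M' → MemM R S M → MemP R S P →
    ∀ (ι : M' →ₗ[R] M) (p : M →ₗ[R] P), Function.Injective ι → Function.Surjective p →
      Function.Exact ι p → F M = F P * F M')

/-- A quasi-Fitting invariant `𝓕 : 𝓒 → Ω`. -/
def IsQuasiFittingInv (R : Type) [Ring R] (S : Submonoid R) {Ω : Type} [CommMonoid Ω]
    (F : (M : Type) → [AddCommGroup M] → [Module R M] → Ω) : Prop :=
  (∀ (P : Type) [AddCommGroup P] [Module R P], MemP R S P → IsUnit (F P)) ∧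
  (∀ (M' M P : Type) [AddCommGroup M'] [Module R M'] [AddCommGroup M] [Module R M]
      [AddCommGroup P] [Module R P], MemC R S M' → MemC R S M → MemP R S P →
    ∀ (ι : M' →ₗ[R] M) (p : M →ₗ[R] P), Function.Injective ι → Function.Surjective p →
      Function.Exact ι p → F M = F P * F M') ∧
  (∀ (P M M' : Type) [AddCommGroup P] [Module R P] [AddCommGroup M] [Module R M]
      [AddCommGroup M'] [Module R M'], MemP R S P → MemC R S M → MemC R S M' →
    ∀ (ι : P →ₗ[R] M) (p : M →ₗ[R] M'), Function.Injective ι → Function.Surjective p →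
      Function.Exact ι p → F M = F P * F M')

/-- The membership predicate of `𝓜` as a family. -/
def MemMFam (R : Type) [Ring R] (S : Submonoid R) (M : Type) [AddCommGroup M] [Module R M] :
    Prop :=
  MemM R S M

/-- The membership predicate of `𝓒` as a family. -/
def MemCFam (R : Type) [Ring R] (S : Submonoid R) (M : Type) [AddCommGroup M] [Module R M] :
    Prop :=
  MemC R S M

/-- `ω` is the value obtained from an exact sequence `0 → N → P₁ → ⋯ → Pₙ → M → 0`
(`n ≥ 0`), with all terms satisfying `Mem`, each `Pᵢ ∈ 𝓟`, via the formula
`ω = (∏ i, 𝓕(Pᵢ)^((-1)^i)) · 𝓕(N)`; inverses are recorded by witnesses `u`. -/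
def PosShiftValue (R : Type) [Ring R] (S : Submonoid R) {Ω : Type} [CommMonoid Ω]
    (Mem : (M : Type) → [AddCommGroup M] → [Module R M] → Prop)
    (F : (M : Type) → [AddCommGroup M] → [Module R M] → Ω) (n : ℕ)
    (M : Type) [AddCommGroup M] [Module R M] (ω : Ω) : Prop :=
  ∃ D : ModSeq R, D.ExactTrunc n ∧ Nonempty (D.C (n+1) ≃ₗ[R] M) ∧
    (∀ i, i ≤ n+1 → Mem (D.C i)) ∧ (∀ i, 1 ≤ i → i ≤ n → MemP R S (D.C i)) ∧
    ∃ u : ℕ → Ω, (∀ i, 1 ≤ i → i ≤ n → F (D.C i) * u i = 1) ∧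
      ω = (∏ i ∈ Finset.range n, if (i+1) % 2 = 1 then u (i+1) else F (D.C (i+1))) * F (D.C 0)

/-- `ω` is the value obtained from an exact sequence `0 → M → P_m → ⋯ → P₁ → N → 0`
(`m ≥ 1` corresponding to the shift `n = -m < 0`) via the formula
`ω = (∏ i, 𝓕(Pᵢ)^((-1)^i)) · 𝓕(N)`. -/
def NegShiftValue (R : Type) [Ring R] (S : Submonoid R) {Ω : Type} [CommMonoid Ω]
    (Mem : (M : Type) → [AddCommGroup M] → [Module R M] → Prop)
    (F : (M : Type) → [AddCommGroup M] → [Module R M] → Ω) (m : ℕ)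
    (M : Type) [AddCommGroup M] [Module R M] (ω : Ω) : Prop :=
  ∃ D : ModSeq R, D.ExactTrunc m ∧ Nonempty (D.C 0 ≃ₗ[R] M) ∧
    (∀ i, i ≤ m+1 → Mem (D.C i)) ∧ (∀ i, 1 ≤ i → i ≤ m → MemP R S (D.C i)) ∧
    ∃ u : ℕ → Ω, (∀ i, 1 ≤ i → i ≤ m → F (D.C i) * u i = 1) ∧
      ω = (∏ i ∈ Finset.range m, if (i+1) % 2 = 1 then u (m-i) else F (D.C (m-i))) * F (D.C (m+1))

/-- `ω` is the value of the `n`-th shift (`n ∈ ℤ`) of `F` at `M` computed from some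
admissible exact sequence whose terms satisfy `Mem`. -/
def ShiftValue (R : Type) [Ring R] (S : Submonoid R) {Ω : Type} [CommMonoid Ω]
    (Mem : (M : Type) → [AddCommGroup M] → [Module R M] → Prop)
    (F : (M : Type) → [AddCommGroup M] → [Module R M] → Ω) (n : ℤ)
    (M : Type) [AddCommGroup M] [Module R M] (ω : Ω) : Prop :=
  if 0 ≤ n then PosShiftValue R S Mem F n.toNat M ω else NegShiftValue R S Mem F (-n).toNat M ω

/-- The axioms for the family of shifts `{𝓕⁽ⁿ⁾ : 𝓜 → Ω}` of a quasi-Fitting invariant. -/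
def IsShiftFamily (R : Type) [Ring R] (S : Submonoid R) {Ω : Type} [CommMonoid Ω]
    (F : (M : Type) → [AddCommGroup M] → [Module R M] → Ω)
    (G : ℤ → (M : Type) → [AddCommGroup M] → [Module R M] → Ω) : Prop :=
  (∀ (M : Type) [AddCommGroup M] [Module R M], MemC R S M → G 0 M = F M) ∧
  (∀ (n : ℤ) (P : Type) [AddCommGroup P] [Module R P], MemQ R S P → IsUnit (G n P)) ∧
  (∀ (n : ℤ) (N P M : Type) [AddCommGroup N] [Module R N] [AddCommGroup P] [Module R P]
      [AddCommGroup M] [Module R M], MemM R S N → MemQ R S P → MemM R S M →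
    ∀ (ι : N →ₗ[R] P) (p : P →ₗ[R] M), Function.Injective ι → Function.Surjective p →
      Function.Exact ι p → G n M = G n P * G (n-1) N) ∧
  (∀ (n : ℤ) (M' M P : Type) [AddCommGroup M'] [Module R M'] [AddCommGroup M] [Module R M]
      [AddCommGroup P] [Module R P], MemM R S M' → MemM R S M → MemQ R S P →
    ∀ (ι : M' →ₗ[R] M) (p : M →ₗ[R] P), Function.Injective ι → Function.Surjective p →
      Function.Exact ι p → G n M = G n P * G n M') ∧
  (∀ (n : ℤ) (P M M' : Type) [AddCommGroup P] [Module R P] [AddCommGroup M] [Module R M]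
      [AddCommGroup M'] [Module R M'], MemQ R S P → MemM R S M → MemM R S M' →
    ∀ (ι : P →ₗ[R] M) (p : M →ₗ[R] M'), Function.Injective ι → Function.Surjective p →
      Function.Exact ι p → G n M = G n P * G n M')

end

open Abelian

/-- Vanishing of the derived-functor `Ext` implies vanishing of the derived-category `Ext`. -/
theorem subsingleton_abelianExt_of_subsingleton_ext {R : Type} [Ring R] {X Y : ModuleCat.{0} R}
    (n : ℕ)
    (h : Subsingleton (((_root_.Ext ℤ (ModuleCat R) (n + 1)).obj (Opposite.op X)).obj Y)) :
    Subsingleton (Abelian.Ext.{0} X Y (n + 1)) := by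
  let P := ProjectiveResolution.of X
  have hz : Limits.IsZero (((_root_.Ext ℤ (ModuleCat R) (n + 1)).obj (Opposite.op X)).obj Y) :=
    ModuleCat.isZero_of_subsingleton _
  have hex := hz.of_iso (P.isoExt (R := ℤ) (n + 1) Y).symm
  rw [← HomologicalComplex.exactAt_iff_isZero_homology,
    HomologicalComplex.exactAt_iff' _ n (n + 1) (n + 2) (by simp) (by simp),
    ShortComplex.moduleCat_exact_iff] at hex
  refine subsingleton_of_forall_eq 0 fun e => ?_
  obtain ⟨f, hf, rfl⟩ := P.extMk_surjective e (n + 2) rfl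
  rw [P.extMk_eq_zero_iff f (n + 2) rfl hf n rfl]
  exact hex f hf

theorem subsingleton_abelianExt_of_finite_projective {R : Type} [Ring R] {X : ModuleCat.{0} R}
    {n : ℕ} (h : Subsingleton (Abelian.Ext.{0} X (ModuleCat.of R R) n))
    (Q : Type) [AddCommGroup Q] [Module R Q] [Module.Finite R Q] [Module.Projective R Q] :
    Subsingleton (Abelian.Ext.{0} X (ModuleCat.of R Q) n) := by
  obtain ⟨k, r, hr⟩ := Module.Finite.exists_fin' R Q
  obtain ⟨s, hs⟩ := Module.projective_lifting_property r LinearMap.id hr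
  let a (j : Fin k) : ModuleCat.of R Q ⟶ ModuleCat.of R R := ModuleCat.ofHom (LinearMap.proj j ∘ₗ s)
  let b (j : Fin k) : ModuleCat.of R R ⟶ ModuleCat.of R Q :=
    ModuleCat.ofHom (r ∘ₗ LinearMap.single R (fun _ : Fin k => R) j)
  have hab : 𝟙 (ModuleCat.of R Q) = ∑ j, a j ≫ b j := by
    ext q
    simp only [a, b, ModuleCat.hom_sum, ModuleCat.hom_comp, LinearMap.sum_apply,
      ModuleCat.hom_id, LinearMap.comp_apply, ModuleCat.hom_ofHom, LinearMap.id_apply,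
      LinearMap.proj_apply]
    simp only [LinearMap.single_apply]
    rw [← map_sum, Finset.univ_sum_single]
    exact (LinearMap.congr_fun hs q).symm
  refine subsingleton_of_forall_eq 0 fun e => ?_
  have hsum : Ext.mk₀ (∑ j, a j ≫ b j) = ∑ j, Ext.mk₀ (a j ≫ b j) :=
    map_sum Ext.addEquiv₀.symm _ _
  rw [← e.comp_mk₀_id, hab, hsum, Ext.comp_sum]
  refine Finset.sum_eq_zero fun j _ => ?_
  rw [← Ext.mk₀_comp_mk₀, ← Ext.comp_assoc_of_second_deg_zero,
    Subsingleton.elim (e.comp (Ext.mk₀ (a j)) (add_zero n)) 0, Ext.zero_comp]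

theorem hasProjectiveDimensionLE_one_of_subsingleton_ext_two {R : Type} [Ring R]
    [IsNoetherianRing R] (M : Type) [AddCommGroup M] [Module R M] [Module.Finite R M]
    (hM : HasProjectiveDimensionLE (ModuleCat.of R M) 2)
    (h : Subsingleton (Abelian.Ext.{0} (ModuleCat.of R M) (ModuleCat.of R R) 2)) :
    HasProjectiveDimensionLE (ModuleCat.of R M) 1 := by
  obtain ⟨l, g, hg⟩ := Module.Finite.exists_fin' R M
  have hT := LinearMap.shortExact_shortComplexKer hg
  obtain ⟨k, f, hf⟩ := Module.Finite.exists_fin' R (LinearMap.ker g)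
  have hS := LinearMap.shortExact_shortComplexKer hf
  have hF : Projective (ModuleCat.of R (Fin l → R)) :=
    (IsProjective.iff_projective _).1 inferInstance
  have hP : Projective (ModuleCat.of R (Fin k → R)) :=
    (IsProjective.iff_projective _).1 inferInstance
  have hK : HasProjectiveDimensionLE (ModuleCat.of R (LinearMap.ker g)) 1 :=
    (hT.hasProjectiveDimensionLT_X₃_iff 1 hF).1 hM
  have hQ : HasProjectiveDimensionLE (ModuleCat.of R (LinearMap.ker f)) 0 :=
    (hS.hasProjectiveDimensionLT_X₃_iff 0 hP).1 hK
  have hQ' : Module.Projective R (LinearMap.ker f) :=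
    (IsProjective.iff_projective _).2 ((projective_iff_hasProjectiveDimensionLE_zero _).2 hQ)
  have h₂ := subsingleton_abelianExt_of_finite_projective h (LinearMap.ker f)
  have hcls : hS.extClass = 0 := by
    obtain ⟨x, hx⟩ := Ext.contravariant_sequence_exact₁ hT _ hS.extClass (n₁ := 2) rfl
      (Subsingleton.elim _ _)
    rw [← hx, Ext.eq_zero_of_projective (P := ModuleCat.of R (Fin l → R)) x, Ext.comp_zero]
  obtain ⟨φ, hφ⟩ := Ext.covariant_sequence_exact₃ (ModuleCat.of R (LinearMap.ker g)) hS
    (Ext.mk₀ (𝟙 _)) (zero_add 1) (by rw [hcls, Ext.comp_zero])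
  obtain ⟨φ, rfl⟩ := Ext.homEquiv₀.symm.surjective φ
  have hret : φ ≫ ModuleCat.ofHom f = 𝟙 _ :=
    Ext.homEquiv₀.symm.injective (by simpa using hφ)
  have hKproj : HasProjectiveDimensionLE (ModuleCat.of R (LinearMap.ker g)) 0 :=
    (Retract.mk φ (ModuleCat.ofHom f) hret).hasProjectiveDimensionLT 1
  exact (hT.hasProjectiveDimensionLT_X₃_iff 0 hF).2 hKproj

theorem pdLE_one_iff {R : Type} [Ring R] (M : Type) [AddCommGroup M] [Module R M]
    [Module.Finite R M] : PdLE R 1 M ↔ HasProjectiveDimensionLE (ModuleCat.of R M) 1 := by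
  have key {k : ℕ} (f : (Fin k → R) →ₗ[R] M) (hf : Function.Surjective f) :
      Module.Projective R (LinearMap.ker f) ↔
        HasProjectiveDimensionLE (ModuleCat.of R M) 1 := by
    rw [IsProjective.iff_projective, projective_iff_hasProjectiveDimensionLE_zero]
    exact ((LinearMap.shortExact_shortComplexKer hf).hasProjectiveDimensionLT_X₃_iff 0
      ((IsProjective.iff_projective (Fin k → R)).1 inferInstance)).symm
  constructor
  · rintro ⟨k, f, hf, h⟩
    exact (key f hf).1 h
  · intro h
    obtain ⟨k, f, hf⟩ := Module.Finite.exists_fin' R M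
    exact ⟨k, f, hf, (key f hf).2 h⟩

/-- Let `R` be left and right noetherian with an Ore set `S` of
non-zero-divisors, satisfying Assumption (⋆).  If `0 → M' → M → M'' → 0` is an exact
sequence in `𝓒` and two of `M'`, `M`, `M''` lie in `𝓟`, then so does the third. -/
theorem statement8
    (R : Type) [Ring R] [IsNoetherianRing R] [IsNoetherianRing Rᵐᵒᵖ]
    (S : Submonoid R) (hS : IsOreSet R S) (hstar : AssumptionStar R)
    (M' M M'' : Type) [AddCommGroup M'] [Module R M'] [AddCommGroup M] [Module R M]
    [AddCommGroup M''] [Module R M'']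
    (hC' : MemC R S M') (hC : MemC R S M) (hC'' : MemC R S M'')
    (ι : M' →ₗ[R] M) (p : M →ₗ[R] M'')
    (hι : Function.Injective ι) (hp : Function.Surjective p) (hex : Function.Exact ι p) :
    (MemP R S M' → MemP R S M → MemP R S M'') ∧
    (MemP R S M' → MemP R S M'' → MemP R S M) ∧
    (MemP R S M → MemP R S M'' → MemP R S M') := by
  have := hC'.1.1
  have := hC.1.1
  have := hC''.1.1
  have hS : (ShortComplex.mk (ModuleCat.ofHom ι) (ModuleCat.ofHom p)
      (ModuleCat.hom_ext hex.linearMap_comp_eq_zero)).ShortExact :=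
    ModuleCat.shortComplex_shortExact _ hex hι hp
  refine ⟨fun h' h => ⟨hC''.1, ?_⟩, fun h' h'' => ⟨hC.1, ?_⟩, fun h h'' => ⟨hC'.1, ?_⟩⟩
  · have h₁ := (pdLE_one_iff M').1 h'.2
    have h₂ := (pdLE_one_iff M).1 h.2
    exact (pdLE_one_iff M'').2 <| hasProjectiveDimensionLE_one_of_subsingleton_ext_two M''
      (hS.hasProjectiveDimensionLT_X₃ 2 h₁ (hasProjectiveDimensionLT_of_ge _ 2 3 (by lia)))
      (subsingleton_abelianExt_of_subsingleton_ext 1 (hC''.2 2 le_rfl))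
  · exact (pdLE_one_iff M).2 <|
      hS.hasProjectiveDimensionLT_X₂ 2 ((pdLE_one_iff M').1 h'.2) ((pdLE_one_iff M'').1 h''.2)
  · have h₃ := (pdLE_one_iff M'').1 h''.2
    exact (pdLE_one_iff M').2 <| hS.hasProjectiveDimensionLT_X₁ 2 ((pdLE_one_iff M).1 h.2)
      (hasProjectiveDimensionLT_of_ge _ 2 3 (by lia))
end

section
/- Let R be a left and right noetherian ring with an Ore set S of non-zero-divisors, satisfying Assumption (⋆). For every M ∈ 𝓒, the annihilator of M^* = Ext^1_R(M, R) in the center Z(R) of R equals the annihilator of M in Z(R): Ann_{Z(R)}(M^*) = Ann_{Z(R)}(M). -/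
open CategoryTheory MulOpposite

section ExtComparison

/-- Vanishing of `Ext` defined as a left derived functor implies vanishing of `Ext` defined in the
derived category, in positive degrees. -/
theorem subsingleton_abelianExt_of_extGroup (R : Type) [Ring R] (M Y : Type) [AddCommGroup M]
    [Module R M] [AddCommGroup Y] [Module R Y] (i : ℕ)
    (h : Subsingleton (extGroup R M Y (i + 1))) :
    Subsingleton (Abelian.Ext (ModuleCat.of R M) (ModuleCat.of R Y) (i + 1)) := by
  let P := projectiveResolution (ModuleCat.of R M)
  have h0 : Limits.IsZero ((P.complex.linearYonedaObj ℤ (ModuleCat.of R Y)).homology (i + 1)) :=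
    (ModuleCat.isZero_of_subsingleton _).of_iso (P.isoExt (R := ℤ) (i + 1) (ModuleCat.of R Y)).symm
  rw [← HomologicalComplex.exactAt_iff_isZero_homology,
    HomologicalComplex.exactAt_iff' _ i (i + 1) (i + 2) (by simp) (by simp),
    ShortComplex.moduleCat_exact_iff] at h0
  refine subsingleton_of_forall_eq 0 fun α => ?_
  obtain ⟨f, hf, rfl⟩ := P.extMk_surjective α (i + 2) rfl
  rw [P.extMk_eq_zero_iff f (i + 2) rfl hf i rfl]
  exact h0 f hf

/-- Dimension shifting in the first variable. -/
theorem subsingleton_abelianExt_of_shift {R : Type} [Ring R] {K P M : Type} [AddCommGroup K]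
    [Module R K] [AddCommGroup P] [Module R P] [AddCommGroup M] [Module R M] [Module.Projective R P]
    (ι : K →ₗ[R] P) (π : P →ₗ[R] M) (hι : Function.Injective ι) (hπ : Function.Surjective π)
    (hex : Function.Exact ι π) (Y : ModuleCat.{0} R) (i : ℕ)
    (h : Subsingleton (Abelian.Ext (ModuleCat.of R M) Y (i + 2))) :
    Subsingleton (Abelian.Ext (ModuleCat.of R K) Y (i + 1)) := by
  have hS := ModuleCat.shortComplex_shortExact
    (ModuleCat.shortComplexOfCompEqZero ι π hex.linearMap_comp_eq_zero) hex hι hπ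
  have : Projective (ModuleCat.of R P) := (IsProjective.iff_projective _).mp inferInstance
  refine subsingleton_of_forall_eq 0 fun x => ?_
  obtain ⟨y, rfl⟩ := Abelian.Ext.contravariant_sequence_exact₁ hS Y x
    (show 1 + (i + 1) = i + 2 by lia) (Subsingleton.elim _ _)
  rw [show y = 0 from Abelian.Ext.eq_zero_of_projective y, Abelian.Ext.comp_zero]

/-- If `Ext¹(M, Y) = 0`, then maps to `Y` extend along injections with cokernel `M`. -/
theorem exists_extension_of_subsingleton_abelianExt {R : Type} [Ring R] {K P M Y : Type}
    [AddCommGroup K] [Module R K] [AddCommGroup P] [Module R P] [AddCommGroup M] [Module R M]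
    [AddCommGroup Y] [Module R Y]
    (ι : K →ₗ[R] P) (π : P →ₗ[R] M) (hι : Function.Injective ι) (hπ : Function.Surjective π)
    (hex : Function.Exact ι π)
    (h : Subsingleton (Abelian.Ext (ModuleCat.of R M) (ModuleCat.of R Y) 1)) (φ : K →ₗ[R] Y) :
    ∃ ψ : P →ₗ[R] Y, ψ ∘ₗ ι = φ := by
  have hS := ModuleCat.shortComplex_shortExact
    (ModuleCat.shortComplexOfCompEqZero ι π hex.linearMap_comp_eq_zero) hex hι hπ
  obtain ⟨y, hy⟩ := Abelian.Ext.contravariant_sequence_exact₁ hS (ModuleCat.of R Y)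
    (Abelian.Ext.mk₀ (ModuleCat.ofHom φ)) (show 1 + 0 = 1 by lia) (Subsingleton.elim _ _)
  obtain ⟨g, rfl⟩ := Abelian.Ext.addEquiv₀.symm.surjective y
  refine ⟨g.hom, ?_⟩
  rw [Abelian.Ext.addEquiv₀_symm_apply, Abelian.Ext.mk₀_comp_mk₀] at hy
  have := Abelian.Ext.addEquiv₀.symm.injective
    (show Abelian.Ext.addEquiv₀.symm _ = Abelian.Ext.addEquiv₀.symm _ from hy)
  exact congrArg ModuleCat.Hom.hom this

end ExtComparison

section Dual

variable {R : Type} [Ring R]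

/-- The right dual of the free left module `Rᵏ` is the free right module of rank `k`. -/
def dualFinFreeEquiv (R : Type) [Ring R] (k : ℕ) :
    ((Fin k → R) →ₗ[R] R) ≃ₗ[Rᵐᵒᵖ] (Fin k → Rᵐᵒᵖ) where
  toFun g i := op (g (Pi.single i 1))
  invFun c := ∑ i, c i • LinearMap.proj i
  map_add' _ _ := rfl
  map_smul' _ _ := rfl
  left_inv g := by
    refine LinearMap.pi_ext' fun i => LinearMap.ext_ring ?_
    simp [Pi.single_apply]
  right_inv c := by
    ext i
    simp [Pi.single_apply]

instance (k : ℕ) : Module.Projective Rᵐᵒᵖ ((Fin k → R) →ₗ[R] R) :=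
  Module.Projective.of_equiv (dualFinFreeEquiv R k).symm

theorem finite_dual [IsNoetherianRing Rᵐᵒᵖ] (N : Type) [AddCommGroup N] [Module R N]
    [Module.Finite R N] : Module.Finite Rᵐᵒᵖ (N →ₗ[R] R) := by
  obtain ⟨k, f, hf⟩ := Module.Finite.exists_fin' R N
  refine Module.Finite.of_injective
    ((dualFinFreeEquiv R k).toLinearMap ∘ₗ precompDual R f) ?_
  rw [LinearMap.coe_comp]
  exact (dualFinFreeEquiv R k).injective.comp fun g h hgh =>
    (LinearMap.cancel_right hf).mp hgh

/-- The functionals on the dual of a finite free module are evaluations. -/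
theorem exists_eval_of_dual_finFree {k : ℕ} (ψ : ((Fin k → R) →ₗ[R] R) →ₗ[Rᵐᵒᵖ] Rᵐᵒᵖ) :
    ∃ p, ∀ g, ψ g = op (g p) := by
  refine ⟨fun i => unop (ψ (LinearMap.proj i)), fun g => ?_⟩
  conv_lhs => rw [← (dualFinFreeEquiv R k).symm_apply_apply g]
  conv_rhs => rw [← (dualFinFreeEquiv R k).symm_apply_apply g]
  simp [dualFinFreeEquiv, map_sum]

/-- `Ext^i_R(N, R) = 0` for all `i ≥ 1`. -/
def ExtPosVanish (R : Type) [Ring R] (N : Type) [AddCommGroup N] [Module R N] : Prop :=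
  ∀ i, Subsingleton (Abelian.Ext (ModuleCat.of R N) (ModuleCat.of R R) (i + 1))

theorem ExtPosVanish.ker {N : Type} [AddCommGroup N] [Module R N] (hN : ExtPosVanish R N) {k : ℕ}
    {f : (Fin k → R) →ₗ[R] N} (hf : Function.Surjective f) :
    ExtPosVanish R (LinearMap.ker f) := fun i =>
  subsingleton_abelianExt_of_shift _ f (LinearMap.ker f).injective_subtype hf
    (LinearMap.exact_subtype_ker_map f) _ i (hN (i + 1))

/-- The dual of the short exact sequence `0 → ker f → Rᵏ → N → 0` is short exact if
`Ext¹(N, R) = 0`. -/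
theorem ExtPosVanish.dual_shortExact {N : Type} [AddCommGroup N] [Module R N]
    (hN : ExtPosVanish R N) {k : ℕ}
    {f : (Fin k → R) →ₗ[R] N} (hf : Function.Surjective f) :
    Function.Injective (precompDual R f) ∧
      Function.Surjective (precompDual R (LinearMap.ker f).subtype) ∧
      Function.Exact (precompDual R f) (precompDual R (LinearMap.ker f).subtype) := by
  refine ⟨fun g h hgh => (LinearMap.cancel_right hf).mp hgh, fun φ => ?_,
    fun g => ⟨fun hg => ?_, ?_⟩⟩
  · exact exists_extension_of_subsingleton_abelianExt _ f (LinearMap.ker f).injective_subtype hf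
      (LinearMap.exact_subtype_ker_map f) (hN 0) φ
  · have hk : LinearMap.ker f ≤ LinearMap.ker g := fun x hx => LinearMap.congr_fun hg ⟨x, hx⟩
    refine ⟨(LinearMap.ker f).liftQ g hk ∘ₗ (f.quotKerEquivOfSurjective hf).symm.toLinearMap, ?_⟩
    refine LinearMap.ext fun x => ?_
    have : (f.quotKerEquivOfSurjective hf).symm (f x) = (LinearMap.ker f).mkQ x := by
      rw [LinearEquiv.symm_apply_eq]; rfl
    change (LinearMap.ker f).liftQ g hk ((f.quotKerEquivOfSurjective hf).symm (f x)) = g x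
    rw [this]; rfl
  · rintro ⟨h, rfl⟩
    refine LinearMap.ext fun x => ?_
    change h (f x.1) = 0
    rw [x.2, map_zero]

theorem ExtPosVanish.ext_dual_subsingleton [IsNoetherianRing R] [IsNoetherianRing Rᵐᵒᵖ] {d : ℕ}
    (hd : ∀ (M : Type) [AddCommGroup M] [Module Rᵐᵒᵖ M], Module.Finite Rᵐᵒᵖ M →
      ∀ i, d < i → ExtRVanish Rᵐᵒᵖ M i) (j : ℕ) :
    ∀ (i : ℕ), d ≤ i + j → ∀ (N : Type) [AddCommGroup N] [Module R N] [Module.Finite R N],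
      ExtPosVanish R N →
      Subsingleton (Abelian.Ext (ModuleCat.of Rᵐᵒᵖ (N →ₗ[R] R)) (ModuleCat.of Rᵐᵒᵖ Rᵐᵒᵖ)
        (i + 1)) := by
  induction j with
  | zero =>
    intro i hi N _ _ _ _
    exact subsingleton_abelianExt_of_extGroup Rᵐᵒᵖ (N →ₗ[R] R) Rᵐᵒᵖ i
      (hd _ (finite_dual N) (i + 1) (by lia))
  | succ j ih =>
    intro i hi N _ _ _ hN
    obtain ⟨k, f, hf⟩ := Module.Finite.exists_fin' R N
    obtain ⟨h1, h2, h3⟩ := hN.dual_shortExact hf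
    exact subsingleton_abelianExt_of_shift _ _ h1 h2 h3 _ i
      (ih (i + 1) (by lia) (LinearMap.ker f) (hN.ker hf))

/-- If `R` has finite injective dimension as a right module, every finitely generated `N` with
`Ext^i(N, R) = 0` for `i ≥ 1` surjects onto its bidual. -/
theorem ExtPosVanish.exists_eval [IsNoetherianRing R] [IsNoetherianRing Rᵐᵒᵖ]
    (hstar : AssumptionStar R) {N : Type} [AddCommGroup N] [Module R N] [Module.Finite R N]
    (hN : ExtPosVanish R N) (φ : (N →ₗ[R] R) →ₗ[Rᵐᵒᵖ] Rᵐᵒᵖ) :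
    ∃ n, ∀ g, φ g = op (g n) := by
  obtain ⟨d, -, hd⟩ := hstar
  obtain ⟨k, f, hf⟩ := Module.Finite.exists_fin' R N
  obtain ⟨h1, h2, h3⟩ := hN.dual_shortExact hf
  obtain ⟨ψ, rfl⟩ := exists_extension_of_subsingleton_abelianExt _ _ h1 h2 h3
    (ExtPosVanish.ext_dual_subsingleton hd d 0 (by lia) (LinearMap.ker f) (hN.ker hf)) φ
  obtain ⟨p, hp⟩ := exists_eval_of_dual_finFree ψ
  exact ⟨f p, fun g => hp _⟩

end Dual

/-- A torsion module has no nonzero functionals. -/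
theorem STorsion.eq_zero {R : Type} [Ring R] {S : Submonoid R} (hS : S ≤ nonZeroDivisors R)
    {M : Type} [AddCommGroup M] [Module R M] (hM : STorsion R S M) {P : Type} [AddCommGroup P]
    [Module R P] {π : P →ₗ[R] M} {h : P →ₗ[R] R} (hk : LinearMap.ker π ≤ LinearMap.ker h) :
    h = 0 := by
  ext x
  obtain ⟨s, hs, hsx⟩ := hM (π x)
  have : h (s • x) = 0 := hk (by simpa using hsx)
  rw [map_smul, smul_eq_mul] at this
  exact (hS hs).1 _ this

/-- Let `R` be left and right noetherian with an Ore set `S` of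
non-zero-divisors, satisfying Assumption (⋆).  For every `M ∈ 𝓒`, the annihilator of
`M^* = Ext^1_R(M, R)` in the center of `R` equals that of `M`.  Here `M^*` is computed
as `ExtOneDual` from any presentation `0 → N → F → M → 0` with `F` finite free. -/
theorem statement9
    (R : Type) [Ring R] [IsNoetherianRing R] [IsNoetherianRing Rᵐᵒᵖ]
    (S : Submonoid R) (hS : IsOreSet R S) (hstar : AssumptionStar R)
    (M : Type) [AddCommGroup M] [Module R M] (hM : MemC R S M)
    (k : ℕ) (N : Type) [AddCommGroup N] [Module R N]
    (ι : N →ₗ[R] (Fin k → R)) (π : (Fin k → R) →ₗ[R] M)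
    (hι : Function.Injective ι) (hπ : Function.Surjective π) (hex : Function.Exact ι π)
    (a : R) (ha : a ∈ Subring.center R) :
    (∀ x : ExtOneDual R ι, (op a) • x = 0) ↔ (∀ m : M, a • m = 0) := by
  have hac : ∀ r : R, r * a = a * r := Subring.mem_center_iff.mp ha
  have hinj : ∀ h : (Fin k → R) →ₗ[R] R, h ∘ₗ ι = 0 → h = 0 := fun h hh =>
    STorsion.eq_zero hS.1 hM.1.2 (π := π) fun x hx => by
      obtain ⟨n, rfl⟩ := (hex x).mp hx
      exact LinearMap.congr_fun hh n
  constructor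
  · intro hann
    have hlift : ∀ g : N →ₗ[R] R, ∃ h : (Fin k → R) →ₗ[R] R, h ∘ₗ ι = op a • g := fun g =>
      (Submodule.Quotient.mk_eq_zero (LinearMap.range (precompDual R ι))).mp
        (hann (Submodule.Quotient.mk g))
    choose H hH using hlift
    have huniq : ∀ g h, h ∘ₗ ι = op a • g → H g = h := fun g h hh =>
      sub_eq_zero.mp (hinj _ (by rw [LinearMap.sub_comp, hH, hh, sub_self]))
    have : Module.Finite R N := Module.Finite.of_injective ι hι
    have hN : ExtPosVanish R N := fun i =>
      subsingleton_abelianExt_of_shift ι π hι hπ hex _ i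
        (subsingleton_abelianExt_of_extGroup R M R (i + 1) (hM.2 (i + 2) (by lia)))
    intro m
    obtain ⟨x, rfl⟩ := hπ m
    let φ : (N →ₗ[R] R) →ₗ[Rᵐᵒᵖ] Rᵐᵒᵖ :=
      { toFun g := op (H g x)
        map_add' g g' := by
          rw [huniq (g + g') (H g + H g') (by rw [LinearMap.add_comp, hH, hH, smul_add])]
          rfl
        map_smul' c g := by
          rw [huniq (c • g) (c • H g) (LinearMap.ext fun n => by
            have := LinearMap.congr_fun (hH g) n
            simp only [LinearMap.comp_apply, LinearMap.smul_apply, MulOpposite.smul_eq_mul_unop,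
              unop_op] at this ⊢
            rw [this, mul_assoc, mul_assoc, hac])]
          rfl }
    obtain ⟨n, hn⟩ := hN.exists_eval hstar φ
    have hax : a • x = ι n := by
      funext i
      have h1 := hn (LinearMap.proj i ∘ₗ ι)
      have h2 := huniq (LinearMap.proj i ∘ₗ ι) (op a • LinearMap.proj i) rfl
      have h3 : H (LinearMap.proj i ∘ₗ ι) x = ι n i := op_injective h1
      rw [h2] at h3
      rw [← h3]
      exact (hac _).symm
    rw [← map_smul, hax]
    exact (hex _).mpr ⟨n, rfl⟩
  · intro hann x
    obtain ⟨g, rfl⟩ := Submodule.Quotient.mk_surjective _ x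
    have hmem : ∀ x : Fin k → R, ∃ n, ι n = a • x := fun x =>
      (hex _).mp (by rw [map_smul, hann])
    choose ν hν using hmem
    rw [← Submodule.Quotient.mk_smul, Submodule.Quotient.mk_eq_zero]
    refine ⟨{ toFun := fun x => g (ν x), map_add' := fun x y => ?_, map_smul' := fun r x => ?_ }, ?_⟩
    · rw [← map_add]
      congr 1
      exact hι (by rw [map_add, hν, hν, hν, smul_add])
    · rw [RingHom.id_apply, ← map_smul]
      congr 1
      exact hι (by rw [map_smul, hν, hν, smul_smul, smul_smul, hac])
    · refine LinearMap.ext fun n => ?_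
      change g (ν (ι n)) = g n * a
      rw [hac, ← smul_eq_mul, ← map_smul]
      congr 1
      exact hι (by rw [hν, map_smul])
end

section
/- Let R be a left and right noetherian ring satisfying Assumption (⋆), and let S be an Ore set of non-zero-divisors of R which is contained in the center of R. Let 𝓕: 𝓜 → Ω be a Fitting invariant. Then for every exact sequence 0 → P → M → M' → 0 in 𝓒 with P ∈ 𝓟, one has 𝓕(M) = 𝓕(P)·𝓕(M'). In particular, the restriction 𝓕|_𝓒 is a quasi-Fitting invariant. -/
open CategoryTheory MulOpposite

section

variable {R : Type} [Ring R]

/-- Multiplication by a central element, as an `R`-linear map. -/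
def centralSMul {s : R} (hs : s ∈ Subring.center R) (M : Type) [AddCommGroup M] [Module R M] :
    M →ₗ[R] M where
  toFun x := s • x
  map_add' := smul_add s
  map_smul' r x := by
    rw [RingHom.id_apply, smul_smul, smul_smul, Subring.mem_center_iff.1 hs r]

@[simp]
theorem centralSMul_apply {s : R} (hs : s ∈ Subring.center R) {M : Type} [AddCommGroup M]
    [Module R M] (x : M) : centralSMul hs M x = s • x :=
  rfl

/-- A linear map vanishing on the kernel of a surjection factors through it. -/
theorem LinearMap.exists_comp_eq_of_surjective {X Y Z : Type} [AddCommGroup X] [Module R X]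
    [AddCommGroup Y] [Module R Y] [AddCommGroup Z] [Module R Z] (p : X →ₗ[R] Y)
    (hp : Function.Surjective p) (g : X →ₗ[R] Z) (h : LinearMap.ker p ≤ LinearMap.ker g) :
    ∃ e : Y →ₗ[R] Z, ∀ x, e (p x) = g x := by
  refine ⟨(LinearMap.ker p).liftQ g h ∘ₗ (p.quotKerEquivOfSurjective hp).symm.toLinearMap,
    fun x => ?_⟩
  have hx : (p.quotKerEquivOfSurjective hp).symm (p x) = (LinearMap.ker p).mkQ x := by
    rw [LinearEquiv.symm_apply_eq]
    rfl
  rw [LinearMap.comp_apply, LinearEquiv.coe_coe, hx, Submodule.mkQ_apply, Submodule.liftQ_apply]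

/-- A linear map with values in the range of an injection factors through it. -/
theorem LinearMap.exists_comp_eq_of_injective {X Y Z : Type} [AddCommGroup X] [Module R X]
    [AddCommGroup Y] [Module R Y] [AddCommGroup Z] [Module R Z] (i : Y →ₗ[R] Z)
    (hi : Function.Injective i) (g : X →ₗ[R] Z) (h : ∀ x, g x ∈ LinearMap.range i) :
    ∃ e : X →ₗ[R] Y, ∀ x, i (e x) = g x := by
  refine ⟨(LinearEquiv.ofInjective i hi).symm.toLinearMap ∘ₗ g.codRestrict _ h, fun x => ?_⟩
  exact congrArg Subtype.val ((LinearEquiv.ofInjective i hi).apply_symm_apply (g.codRestrict _ h x))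

/-- If `Ext²(M, R) = 0`, some projective presentation `F₁ → F₀ → M → 0` has the property that every
functional on the kernel of `F₁ → F₀` extends to `F₁`. -/
theorem exists_presentation_extending_dual {M : Type} [AddCommGroup M] [Module R M]
    (h : ExtRVanish R M 2) :
    ∃ (F₀ F₁ : ModuleCat.{0} R) (d : F₁ →ₗ[R] F₀) (π : F₀ →ₗ[R] M),
      Module.Projective R F₀ ∧ Module.Projective R F₁ ∧ Function.Surjective π ∧
      Function.Exact d π ∧
      ∀ v : LinearMap.ker d →ₗ[R] R, ∃ w : F₁ →ₗ[R] R, ∀ x : LinearMap.ker d, w x = v x := by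
  let P := projectiveResolution (ModuleCat.of R M)
  have hE : Subsingleton ((P.complex.linearYonedaObj ℤ (ModuleCat.of R R)).homology 2) :=
    (P.isoExt (R := ℤ) 2 (ModuleCat.of R R)).toLinearEquiv.symm.toEquiv.subsingleton_congr.2 h
  have hZ : ((P.complex.linearYonedaObj ℤ (ModuleCat.of R R)).ExactAt 2) := by
    rw [HomologicalComplex.exactAt_iff_isZero_homology]
    exact ModuleCat.isZero_of_subsingleton _
  rw [HomologicalComplex.exactAt_iff' _ 1 2 3 (by simp) (by simp),
    ShortComplex.moduleCat_exact_iff] at hZ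
  have e1 := (ShortComplex.ShortExact.moduleCat_exact_iff_function_exact _).1 P.exact₀
  have e2 := (ShortComplex.ShortExact.moduleCat_exact_iff_function_exact _).1 (P.exact_succ 0)
  refine ⟨P.complex.X 0, P.complex.X 1, (P.complex.d 1 0).hom, (P.π.f 0).hom,
    ?_, ?_, ?_, ?_, ?_⟩
  · exact (IsProjective.iff_projective _).2 (P.projective 0)
  · exact (IsProjective.iff_projective _).2 (P.projective 1)
  · exact (ModuleCat.epi_iff_surjective _).1 inferInstance
  · exact e1
  · intro v
    let q : P.complex.X 2 →ₗ[R] LinearMap.ker (P.complex.d 1 0).hom :=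
      (P.complex.d 2 1).hom.codRestrict _ fun x => e2.apply_apply_eq_zero x
    have hq : P.complex.d 3 2 ≫ ModuleCat.ofHom (v ∘ₗ q) = 0 := by
      ext x
      have hx : q ((P.complex.d 3 2).hom x) = 0 := by
        apply Subtype.ext
        exact congrArg (fun f => f.hom x) (P.complex.d_comp_d 3 2 1)
      exact (congrArg v hx).trans (map_zero v)
    obtain ⟨w, hw⟩ := hZ (ModuleCat.ofHom (v ∘ₗ q)) hq
    refine ⟨w.hom, fun x => ?_⟩
    obtain ⟨y, hy⟩ := (e2 x.1).1 x.2
    have hxy : q y = x := Subtype.ext hy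
    have := congrArg (fun f : P.complex.X 2 ⟶ ModuleCat.of R R => f.hom y) hw
    rw [← hxy]
    exact this

/-- Extensions of functionals yield extensions of maps to finitely generated projective modules. -/
theorem exists_extension_to_projective {X : Type} [AddCommGroup X] [Module R X]
    (L : Submodule R X)
    (h : ∀ v : L →ₗ[R] R, ∃ w : X →ₗ[R] R, ∀ x : L, w x = v x)
    (A : Type) [AddCommGroup A] [Module R A] [Module.Finite R A] [Module.Projective R A]
    (v : L →ₗ[R] A) : ∃ w : X →ₗ[R] A, ∀ x : L, w x = v x := by
  obtain ⟨n, ρ, hρ⟩ := Module.Finite.exists_fin' R A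
  obtain ⟨σ, hσ⟩ := LinearMap.exists_rightInverse_of_surjective ρ (LinearMap.range_eq_top.2 hρ)
  choose w hw using fun i => h (LinearMap.proj i ∘ₗ σ ∘ₗ v)
  refine ⟨ρ ∘ₗ LinearMap.pi w, fun x => ?_⟩
  have hx : LinearMap.pi w (x : X) = σ (v x) := funext fun i => hw i x
  rw [LinearMap.comp_apply, hx]
  exact LinearMap.congr_fun hσ (v x)

/-- Vanishing of `Ext²` lets maps from the first syzygy to `A / sA` be lifted to `A`. -/
theorem exists_lift_of_extending_dual {F₀ F₁ M A : Type} [AddCommGroup F₀] [Module R F₀]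
    [AddCommGroup F₁] [Module R F₁] [AddCommGroup M] [Module R M] [AddCommGroup A] [Module R A]
    [Module.Projective R F₁] [Module.Finite R A] [Module.Projective R A]
    {d : F₁ →ₗ[R] F₀} {π : F₀ →ₗ[R] M} (hd : Function.Exact d π)
    (h : ∀ v : LinearMap.ker d →ₗ[R] R, ∃ w : F₁ →ₗ[R] R, ∀ x : LinearMap.ker d, w x = v x)
    {s : R} (hs : s ∈ Subring.center R) (hinj : Function.Injective (centralSMul hs A))
    (f : LinearMap.ker π →ₗ[R] A ⧸ LinearMap.range (centralSMul hs A)) :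
    ∃ g : LinearMap.ker π →ₗ[R] A, ∀ x, (LinearMap.range (centralSMul hs A)).mkQ (g x) = f x := by
  let d' : F₁ →ₗ[R] LinearMap.ker π := d.codRestrict _ hd.apply_apply_eq_zero
  have hd' : Function.Surjective d' := fun x => by
    obtain ⟨y, hy⟩ := (hd x.1).1 x.2
    exact ⟨y, Subtype.ext hy⟩
  obtain ⟨u, hu⟩ := Module.projective_lifting_property (LinearMap.range (centralSMul hs A)).mkQ
    (f ∘ₗ d') (Submodule.mkQ_surjective _)
  have hu' : ∀ x, (LinearMap.range (centralSMul hs A)).mkQ (u x) = f (d' x) :=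
    LinearMap.congr_fun hu
  have h0 : ∀ x : LinearMap.ker d, d' x = 0 := fun x => Subtype.ext x.2
  obtain ⟨v, hv⟩ := LinearMap.exists_comp_eq_of_injective (centralSMul hs A) hinj
    (u ∘ₗ (LinearMap.ker d).subtype) fun x => by
      rw [← Submodule.Quotient.mk_eq_zero, ← Submodule.mkQ_apply]
      exact (hu' x).trans (by rw [h0, map_zero])
  obtain ⟨w, hw⟩ := exists_extension_to_projective _ h A v
  obtain ⟨g, hg⟩ := LinearMap.exists_comp_eq_of_surjective d' hd' (u - centralSMul hs A ∘ₗ w)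
    fun x hx => by
      have hx' : x ∈ LinearMap.ker d := congrArg Subtype.val (LinearMap.mem_ker.1 hx)
      have h1 := hv ⟨x, hx'⟩
      rw [← hw] at h1
      exact sub_eq_zero.2 h1.symm
  refine ⟨g, fun x => ?_⟩
  obtain ⟨y, rfl⟩ := hd' x
  rw [hg, LinearMap.sub_apply, map_sub, hu', sub_eq_self, Submodule.mkQ_apply,
    Submodule.Quotient.mk_eq_zero]
  exact ⟨w y, rfl⟩

/-- If `s` kills `M` and `Ext²(M', R) = 0`, then maps `P → A / sA` extend along `P ↪ M` with
quotient `M'`. -/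
theorem exists_extension_of_extRVanish {P M M' A : Type} [AddCommGroup P] [Module R P]
    [AddCommGroup M] [Module R M] [AddCommGroup M'] [Module R M'] [AddCommGroup A] [Module R A]
    [Module.Finite R A] [Module.Projective R A] (hM' : ExtRVanish R M' 2)
    {ι : P →ₗ[R] M} {p : M →ₗ[R] M'} (hι : Function.Injective ι) (hp : Function.Surjective p)
    (hex : Function.Exact ι p) {s : R} (hs : s ∈ Subring.center R)
    (hinj : Function.Injective (centralSMul hs A)) (hsM : ∀ m : M, s • m = 0)
    (f : P →ₗ[R] A ⧸ LinearMap.range (centralSMul hs A)) :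
    ∃ e : M →ₗ[R] A ⧸ LinearMap.range (centralSMul hs A), ∀ x, e (ι x) = f x := by
  obtain ⟨F₀, F₁, d, π, _, _, hπ, hd, hdual⟩ := exists_presentation_extending_dual hM'
  obtain ⟨φ, hφ⟩ := Module.projective_lifting_property p π hp
  have hφ' : ∀ x, p (φ x) = π x := LinearMap.congr_fun hφ
  obtain ⟨ψ, hψ⟩ := LinearMap.exists_comp_eq_of_injective ι hι
    (φ ∘ₗ (LinearMap.ker π).subtype) fun x => (hex _).1 ((hφ' x).trans x.2)
  obtain ⟨h, hh⟩ := exists_lift_of_extending_dual hd hdual hs hinj (f ∘ₗ ψ)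
  let θ : F₀ →ₗ[R] LinearMap.ker π := (centralSMul hs F₀).codRestrict _ fun x => by
    rw [LinearMap.mem_ker, centralSMul_apply, map_smul, ← hφ', ← map_smul, hsM, map_zero]
  obtain ⟨g, hg⟩ := LinearMap.exists_comp_eq_of_injective (centralSMul hs A) hinj (h ∘ₗ θ)
    fun x => by
      rw [← Submodule.Quotient.mk_eq_zero, ← Submodule.mkQ_apply, LinearMap.comp_apply, hh]
      have hx : ψ (θ x) = 0 := hι <| by
        rw [hψ, map_zero]
        exact (map_smul φ s x).trans (hsM _)
      rw [LinearMap.comp_apply, hx, map_zero]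
  have hgh : ∀ x : LinearMap.ker π, g x = h x := fun x => hinj <| by
    rw [hg]
    exact map_smul h s x
  obtain ⟨e, he⟩ := LinearMap.exists_comp_eq_of_surjective (φ.coprod ι)
    (fun m => by
      obtain ⟨x, hx⟩ := hπ (p m)
      obtain ⟨y, hy⟩ := (hex (m - φ x)).1 (by rw [map_sub, hφ', hx, sub_self])
      exact ⟨(x, y), by rw [LinearMap.coprod_apply, hy, add_sub_cancel]⟩)
    (((LinearMap.range (centralSMul hs A)).mkQ ∘ₗ g).coprod f) fun z hz => by
      obtain ⟨x, y⟩ := z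
      rw [LinearMap.mem_ker, LinearMap.coprod_apply] at hz
      have hx : x ∈ LinearMap.ker π := by
        have := congrArg p hz
        rwa [map_add, hφ', hex.apply_apply_eq_zero, add_zero, map_zero] at this
      have hxy : ψ ⟨x, hx⟩ + y = 0 := hι <| by
        rw [map_add, hψ, map_zero]
        exact hz
      have := hgh ⟨x, hx⟩
      rw [LinearMap.mem_ker, LinearMap.coprod_apply, LinearMap.comp_apply, this, hh,
        LinearMap.comp_apply, ← map_add, hxy, map_zero]
  refine ⟨e, fun x => ?_⟩
  simpa using he (0, x)

/-- An extension of projective modules is projective. -/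
theorem Module.Projective.of_surjective_of_ker {X Y : Type} [AddCommGroup X] [Module R X]
    [AddCommGroup Y] [Module R Y] [Module.Projective R Y] (p : X →ₗ[R] Y)
    (hp : Function.Surjective p) [Module.Projective R (LinearMap.ker p)] :
    Module.Projective R X := by
  obtain ⟨σ, hσ⟩ := LinearMap.exists_rightInverse_of_surjective p (LinearMap.range_eq_top.2 hp)
  have hσ' : ∀ y, p (σ y) = y := LinearMap.congr_fun hσ
  let q : X →ₗ[R] LinearMap.ker p := (LinearMap.id - σ ∘ₗ p).codRestrict _ fun x => by
    simp [hσ']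
  refine Module.Projective.of_split (q.prod p) ((LinearMap.ker p).subtype.coprod σ) ?_
  ext x
  simp [q]

/-- The kernel of a surjection of projective modules is projective. -/
theorem Module.Projective.ker_of_surjective {X Y : Type} [AddCommGroup X] [Module R X]
    [AddCommGroup Y] [Module R Y] [Module.Projective R X] [Module.Projective R Y] (p : X →ₗ[R] Y)
    (hp : Function.Surjective p) : Module.Projective R (LinearMap.ker p) := by
  obtain ⟨σ, hσ⟩ := LinearMap.exists_rightInverse_of_surjective p (LinearMap.range_eq_top.2 hp)
  have hσ' : ∀ y, p (σ y) = y := LinearMap.congr_fun hσ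
  refine Module.Projective.of_split (LinearMap.ker p).subtype
    ((LinearMap.id - σ ∘ₗ p).codRestrict _ fun x => by simp [hσ']) ?_
  ext x
  simp

/-- A quotient of a finitely generated projective module by a projective submodule has projective
dimension at most one. -/
theorem pdLE_one_quotient {A : Type} [AddCommGroup A] [Module R A] [Module.Finite R A]
    [Module.Projective R A] (N : Submodule R A) [Module.Projective R N] : PdLE R 1 (A ⧸ N) := by
  obtain ⟨n, ρ, hρ⟩ := Module.Finite.exists_fin' R A
  refine ⟨n, N.mkQ ∘ₗ ρ, (Submodule.mkQ_surjective N).comp hρ, ?_⟩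
  change Module.Projective R (LinearMap.ker (N.mkQ ∘ₗ ρ))
  have hker : ∀ x : LinearMap.ker (N.mkQ ∘ₗ ρ), ρ x ∈ N := fun x =>
    (Submodule.Quotient.mk_eq_zero N).1 x.2
  let p : LinearMap.ker (N.mkQ ∘ₗ ρ) →ₗ[R] N :=
    (ρ ∘ₗ (LinearMap.ker (N.mkQ ∘ₗ ρ)).subtype).codRestrict N hker
  have hp : Function.Surjective p := fun y => by
    obtain ⟨x, hx⟩ := hρ y
    have hx' : x ∈ LinearMap.ker (N.mkQ ∘ₗ ρ) :=
      (Submodule.Quotient.mk_eq_zero N).2 (hx ▸ y.2)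
    exact ⟨⟨x, hx'⟩, Subtype.ext hx⟩
  have hproj := Module.Projective.ker_of_surjective ρ hρ
  have : Module.Projective R (LinearMap.ker p) :=
    Module.Projective.of_split
      ((LinearMap.ker (N.mkQ ∘ₗ ρ)).subtype.comp (LinearMap.ker p).subtype |>.codRestrict
        (LinearMap.ker ρ) fun x => congrArg Subtype.val x.2)
      (((LinearMap.ker ρ).subtype.codRestrict (LinearMap.ker (N.mkQ ∘ₗ ρ)) fun x => by
        rw [LinearMap.mem_ker, LinearMap.comp_apply, Submodule.subtype_apply, x.2,
          map_zero]).codRestrict (LinearMap.ker p) fun x => Subtype.ext x.2)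
      rfl
  exact Module.Projective.of_surjective_of_ker p hp

/-- A finitely generated torsion module is killed by a single element of a central submonoid. -/
theorem exists_smul_eq_zero_of_memM {S : Submonoid R} (hcentral : ∀ s ∈ S, s ∈ Subring.center R)
    {M : Type} [AddCommGroup M] [Module R M] (hM : MemM R S M) : ∃ s ∈ S, ∀ m : M, s • m = 0 := by
  classical
  obtain ⟨⟨t, ht⟩, htors⟩ := hM
  have key : ∀ t : Finset M, ∃ s ∈ S, ∀ m ∈ t, s • m = 0 := fun t => by
    induction t using Finset.induction_on with
    | empty => exact ⟨1, S.one_mem, by simp⟩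
    | insert a t _ ih =>
      obtain ⟨s, hs, hst⟩ := ih
      obtain ⟨r, hr, hra⟩ := htors a
      refine ⟨s * r, S.mul_mem hs hr, fun m hm => ?_⟩
      obtain rfl | hm := Finset.mem_insert.1 hm
      · rw [mul_smul, hra, smul_zero]
      · rw [← Subring.mem_center_iff.1 (hcentral s hs) r, mul_smul, hst m hm, smul_zero]
  obtain ⟨s, hs, hst⟩ := key t
  refine ⟨s, hs, fun m => ?_⟩
  have hle : Submodule.span R (t : Set M) ≤ LinearMap.ker (centralSMul (hcentral s hs) M) :=
    Submodule.span_le.2 hst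
  exact hle (ht ▸ Submodule.mem_top : m ∈ Submodule.span R (t : Set M))

/-- A quotient of a finitely generated projective module by a projective submodule containing
its multiples by `s ∈ S` lies in `𝓟`. -/
theorem memP_quotient {S : Submonoid R} {s : R} (hsS : s ∈ S) {A : Type} [AddCommGroup A]
    [Module R A] [Module.Finite R A] [Module.Projective R A] (N : Submodule R A)
    [Module.Projective R N] (hN : ∀ a : A, s • a ∈ N) : MemP R S (A ⧸ N) := by
  refine ⟨⟨inferInstance, fun x => ⟨s, hsS, ?_⟩⟩, pdLE_one_quotient N⟩
  obtain ⟨a, rfl⟩ := Submodule.mkQ_surjective N x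
  exact (map_smul N.mkQ s a).symm.trans ((Submodule.Quotient.mk_eq_zero N).2 (hN a))

/-- A module of projective dimension at most one killed by a central nonzerodivisor `s` embeds into
`A / sA` for a finitely generated projective module `A`, with cokernel `A / N` for a projective
submodule `N`. -/
theorem exists_embedding_of_pdLE_one {P : Type} [AddCommGroup P] [Module R P]
    (hP : PdLE R 1 P) {s : R} (hs : s ∈ Subring.center R) (hs0 : s ∈ nonZeroDivisors R)
    (hsP : ∀ x : P, s • x = 0) :
    ∃ (k : ℕ) (A : Submodule R (Fin k → R)) (N : Submodule R A)
      (hN : LinearMap.range (centralSMul hs A) ≤ N)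
      (j : P →ₗ[R] A ⧸ LinearMap.range (centralSMul hs A)),
      Module.Projective R A ∧ Module.Projective R N ∧ Function.Injective (centralSMul hs A) ∧
      Function.Injective j ∧ Function.Exact j (Submodule.factor hN) := by
  obtain ⟨k, f, hf, hA⟩ := hP
  change Module.Projective R (LinearMap.ker f) at hA
  have hinj : ∀ x y : Fin k → R, s • x = s • y → x = y := fun x y hxy => funext fun i => by
    have h : s * (x i - y i) = 0 := by
      rw [mul_sub, sub_eq_zero]
      exact congrFun hxy i
    exact sub_eq_zero.1 (hs0.1 _ h)
  let τ : (Fin k → R) →ₗ[R] LinearMap.ker f := (centralSMul hs _).codRestrict _ fun x =>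
    (map_smul f s x).trans (hsP _)
  have hτ : Function.Injective τ := fun x y hxy => hinj x y (congrArg Subtype.val hxy)
  have hN : LinearMap.range (centralSMul hs (LinearMap.ker f)) ≤ LinearMap.range τ := by
    rintro _ ⟨a, rfl⟩
    exact ⟨a, rfl⟩
  obtain ⟨j, hj⟩ := LinearMap.exists_comp_eq_of_surjective f hf
    ((LinearMap.range (centralSMul hs (LinearMap.ker f))).mkQ ∘ₗ τ) fun x hx =>
      (Submodule.Quotient.mk_eq_zero _).2 ⟨⟨x, hx⟩, rfl⟩
  refine ⟨k, LinearMap.ker f, LinearMap.range τ, hN, j, hA,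
    Module.Projective.of_equiv (LinearEquiv.ofInjective τ hτ),
    fun x y hxy => Subtype.ext (hinj _ _ (congrArg Subtype.val hxy)), ?_, ?_⟩
  · refine (injective_iff_map_eq_zero j).2 fun y hy => ?_
    obtain ⟨x, rfl⟩ := hf y
    rw [hj] at hy
    obtain ⟨a, ha⟩ := (Submodule.Quotient.mk_eq_zero _).1 hy
    have hax : (a : Fin k → R) = x := hinj _ _ (congrArg Subtype.val ha)
    exact hax ▸ a.2
  · intro y
    obtain ⟨a, rfl⟩ := Submodule.mkQ_surjective _ y
    refine Iff.trans (Submodule.Quotient.mk_eq_zero (LinearMap.range τ)) ⟨?_, ?_⟩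
    · rintro ⟨x, rfl⟩
      exact ⟨f x, hj x⟩
    · rintro ⟨z, hz⟩
      obtain ⟨x, rfl⟩ := hf z
      rw [hj] at hz
      obtain ⟨b, hb⟩ := (Submodule.Quotient.eq _).1 hz
      refine (Submodule.sub_mem_iff_right _ (LinearMap.mem_range_self τ x)).1 ?_
      change τ x - a ∈ _
      rw [← hb]
      exact hN (LinearMap.mem_range_self _ b)

/-- A Fitting invariant is multiplicative along `0 → P → M → M' → 0` as soon as `P` embeds into some
`Q ∈ 𝓟` with cokernel `C ∈ 𝓟`, by a map which extends to `M`. -/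
theorem IsFittingInv.eq_mul_of_extension {S : Submonoid R} {Ω : Type} [CommMonoid Ω]
    {F : (M : Type) → [AddCommGroup M] → [Module R M] → Ω} (hF : IsFittingInv R S F)
    {P M M' Q C : Type} [AddCommGroup P] [Module R P] [AddCommGroup M] [Module R M]
    [AddCommGroup M'] [Module R M'] [AddCommGroup Q] [Module R Q] [AddCommGroup C] [Module R C]
    (hP : MemM R S P) (hM : MemM R S M) (hM' : MemM R S M') (hQ : MemP R S Q) (hC : MemP R S C)
    (hQM' : MemM R S (Q × M'))
    {ι : P →ₗ[R] M} {p : M →ₗ[R] M'} (hp : Function.Surjective p) (hex : Function.Exact ι p)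
    {j : P →ₗ[R] Q} {q : Q →ₗ[R] C} (hj : Function.Injective j) (hq : Function.Surjective q)
    (hjq : Function.Exact j q) {e : M →ₗ[R] Q} (he : ∀ x, e (ι x) = j x) :
    F M = F P * F M' := by
  obtain ⟨b, hb⟩ := LinearMap.exists_comp_eq_of_surjective p hp (q ∘ₗ e) fun m hm => by
    obtain ⟨x, rfl⟩ := (hex m).1 hm
    rw [LinearMap.mem_ker, LinearMap.comp_apply, he, hjq.apply_apply_eq_zero]
  have h₁ : F (Q × M') = F C * F M := by
    refine hF.2 M (Q × M') C hM hQM' hC (e.prod p) (q.coprod (-b)) ?_ ?_ ?_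
    · refine (injective_iff_map_eq_zero (e.prod p)).2 fun m hm => ?_
      obtain ⟨h1, h2⟩ := Prod.ext_iff.1 hm
      obtain ⟨x, rfl⟩ := (hex m).1 h2
      have hx : j x = j 0 := by rw [← he, map_zero]; exact h1
      rw [hj hx, map_zero]
    · intro c
      obtain ⟨y, rfl⟩ := hq c
      exact ⟨(y, 0), by simp⟩
    · rintro ⟨y, m'⟩
      obtain ⟨m, rfl⟩ := hp m'
      constructor
      · intro h
        have h' : q (y - e m) = 0 := by
          simpa [hb, sub_eq_add_neg] using h
        obtain ⟨x, hx⟩ := (hjq _).1 h'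
        refine ⟨m + ι x, Prod.ext ?_ ?_⟩
        · simp [he, hx]
        · simp [hex.apply_apply_eq_zero]
      · rintro ⟨n, hn⟩
        rw [← hn]
        simp [hb]
  have h₂ : F (Q × M') = F Q * F M' :=
    hF.2 M' (Q × M') Q hM' hQM' hQ (LinearMap.inr R Q M') (LinearMap.fst R Q M')
      LinearMap.inr_injective LinearMap.fst_surjective .inr_fst
  have h₃ : F Q = F C * F P := hF.2 P Q C hP hQ.1 hC j q hj hq hjq
  refine (hF.1 C hC).mul_left_cancel ?_
  rw [← h₁, h₂, h₃, mul_assoc]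

end

/-- Let `R` be left and right noetherian satisfying Assumption (⋆),
and let `S` be an Ore set of non-zero-divisors contained in the center of `R`.  If
`𝓕 : 𝓜 → Ω` is a Fitting invariant, then `𝓕(M) = 𝓕(P)·𝓕(M')` for every exact sequence
`0 → P → M → M' → 0` in `𝓒` with `P ∈ 𝓟`; in particular the restriction `𝓕|𝓒` is a
quasi-Fitting invariant. -/
theorem statement10
    (R : Type) [Ring R] [IsNoetherianRing R] [IsNoetherianRing Rᵐᵒᵖ]
    (hstar : AssumptionStar R)
    (S : Submonoid R) (hS : S ≤ nonZeroDivisors R)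
    (hcentral : ∀ s ∈ S, s ∈ Subring.center R)
    (Ω : Type) [CommMonoid Ω]
    (F : (M : Type) → [AddCommGroup M] → [Module R M] → Ω)
    (hF : IsFittingInv R S F) :
    (∀ (P M M' : Type) [AddCommGroup P] [Module R P] [AddCommGroup M] [Module R M]
        [AddCommGroup M'] [Module R M'], MemP R S P → MemC R S M → MemC R S M' →
      ∀ (ι : P →ₗ[R] M) (p : M →ₗ[R] M'), Function.Injective ι → Function.Surjective p →
        Function.Exact ι p → F M = F P * F M') ∧
    IsQuasiFittingInv R S F := by
  have main : ∀ (P M M' : Type) [AddCommGroup P] [Module R P] [AddCommGroup M] [Module R M]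
        [AddCommGroup M'] [Module R M'], MemP R S P → MemC R S M → MemC R S M' →
      ∀ (ι : P →ₗ[R] M) (p : M →ₗ[R] M'), Function.Injective ι → Function.Surjective p →
        Function.Exact ι p → F M = F P * F M' := by
    intro P M M' _ _ _ _ _ _ hP hM hM' ι p hι hp hex
    obtain ⟨s, hsS, hsM⟩ := exists_smul_eq_zero_of_memM hcentral hM.1
    have hs := hcentral s hsS
    have hsP : ∀ x : P, s • x = 0 := fun x => hι <| by rw [map_smul, hsM, map_zero]
    have hsM' : ∀ x : M', s • x = 0 := fun x => by
      obtain ⟨m, rfl⟩ := hp x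
      rw [← map_smul, hsM, map_zero]
    obtain ⟨k, A, N, hN, j, _, _, hA, hj, hjN⟩ :=
      exists_embedding_of_pdLE_one hP.2 hs (hS hsS) hsP
    obtain ⟨e, he⟩ := exists_extension_of_extRVanish (hM'.2 2 le_rfl) hι hp hex hs hA hsM j
    have := Module.Projective.of_equiv (LinearEquiv.ofInjective (centralSMul hs A) hA)
    have hQ : MemP R S (A ⧸ LinearMap.range (centralSMul hs A)) :=
      memP_quotient hsS _ fun a => ⟨a, rfl⟩
    have hQM' : MemM R S ((A ⧸ LinearMap.range (centralSMul hs A)) × M') := by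
      have := hM'.1.1
      refine ⟨inferInstance, fun x => ?_⟩
      obtain ⟨r, hr, hrx⟩ := hQ.1.2 x.1
      refine ⟨s * r, S.mul_mem hsS hr, Prod.ext ?_ ?_⟩
      · change (s * r) • x.1 = 0
        rw [mul_smul, hrx, smul_zero]
      · change (s * r) • x.2 = 0
        rw [mul_smul, hsM']
    exact hF.eq_mul_of_extension hP.1 hM.1 hM'.1 hQ
      (memP_quotient hsS N fun a => hN ⟨a, rfl⟩) hQM' hp hex hj
      (Submodule.factor_surjective hN) hjN he
  exact ⟨main, hF.1, fun M' M P _ _ _ _ _ _ hM' hM hP => hF.2 M' M P hM'.1 hM.1 hP, main⟩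
end
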